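/- arXiv:1701.05298 — 2 statements merged into one kernel-verified Lean document; each statement's English description precedes it below -/
import Mathlib

section
/- Fix ρ > 0, μ ∈ ℝᵐ, λ ∈ E and x ∈ ℝⁿ. Then the infimum over y ∈ E of the augmented Lagrangian 𝓛ρ^Slack(x, y, μ, λ) is attained and equals f(x) − ⟨h(x), μ⟩ + (ρ/2)‖h(x)‖² + (1/(2ρ))(−‖λ‖² + ‖P_K(λ − ρ g(x))‖²). Moreover, any minimizer y* of y ↦ 𝓛ρ^Slack(x, y, μ, λ) satisfies y*∘y* = P_K(g(x) − λ/ρ). -/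
open scoped RealInnerProductSpace

noncomputable section

/-- A Euclidean Jordan algebra structure on a finite-dimensional real inner
product space `E`: a commutative bilinear product `jmul` with unit, satisfying
the Jordan identity and compatibility with the inner product, together with the
spectral theorem (every element has a spectral decomposition along a Jordan
frame of size `rank`) and the normalization `⟪c, c⟫ = 1` for primitive
idempotents, which encodes that the inner product is the trace form. -/
structure EJA (E : Type*) [NormedAddCommGroup E] [InnerProductSpace ℝ E]
    [FiniteDimensional ℝ E] where
  jmul : E →ₗ[ℝ] E →ₗ[ℝ] E
  comm : ∀ y z : E, jmul y z = jmul z y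
  unit : E
  unit_jmul : ∀ y : E, jmul unit y = y
  jordan : ∀ y z : E, jmul y (jmul (jmul y y) z) = jmul (jmul y y) (jmul y z)
  assoc_inner : ∀ y z w : E, ⟪jmul y z, w⟫ = ⟪y, jmul z w⟫
  rank : ℕ
  spectral : ∀ y : E, ∃ (c : Fin rank → E) (σ : Fin rank → ℝ),
    (∀ i, jmul (c i) (c i) = c i) ∧
    (∀ i, c i ≠ 0) ∧
    (∀ i, ∀ a b : E, jmul a a = a → jmul b b = b → a ≠ 0 → b ≠ 0 →
      jmul a b = 0 → c i ≠ a + b) ∧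
    (∀ i j, i ≠ j → jmul (c i) (c j) = 0) ∧
    (∑ i, c i) = unit ∧
    y = ∑ i, σ i • c i
  inner_primitive : ∀ c : E, jmul c c = c → c ≠ 0 →
    (∀ a b : E, jmul a a = a → jmul b b = b → a ≠ 0 → b ≠ 0 →
      jmul a b = 0 → c ≠ a + b) →
    ⟪c, c⟫ = 1

namespace EJA

variable {E : Type*} [NormedAddCommGroup E] [InnerProductSpace ℝ E]
  [FiniteDimensional ℝ E]

/-- `c` is an idempotent. -/
def IsIdempotent (J : EJA E) (c : E) : Prop := J.jmul c c = c

/-- `c` is a primitive idempotent. -/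
def IsPrimitive (J : EJA E) (c : E) : Prop :=
  J.IsIdempotent c ∧ c ≠ 0 ∧
    ∀ a b : E, J.IsIdempotent a → J.IsIdempotent b → a ≠ 0 → b ≠ 0 →
      J.jmul a b = 0 → c ≠ a + b

/-- A Jordan frame: primitive idempotents, pairwise orthogonal (w.r.t. the
Jordan product), summing to the unit. -/
def IsJordanFrame (J : EJA E) (c : Fin J.rank → E) : Prop :=
  (∀ i, J.IsPrimitive (c i)) ∧ (∀ i j, i ≠ j → J.jmul (c i) (c j) = 0) ∧
    (∑ i, c i) = J.unit

/-- The symmetric cone: the cone of squares of the algebra. -/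
def K (J : EJA E) : Set E := {z : E | ∃ y : E, z = J.jmul y y}

/-- `y` has rank `k`: some spectral decomposition of `y` has exactly `k`
nonzero eigenvalues.  (By uniqueness of eigenvalues this is well-defined.) -/
def HasRank (J : EJA E) (y : E) (k : ℕ) : Prop :=
  ∃ (c : Fin J.rank → E) (σ : Fin J.rank → ℝ),
    J.IsJordanFrame c ∧ y = ∑ i, σ i • c i ∧
      (Finset.univ.filter (fun i => σ i ≠ 0)).card = k

/-- `t` is an eigenvalue of `y`. -/
def IsEigenvalue (J : EJA E) (y : E) (t : ℝ) : Prop :=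
  ∃ (c : Fin J.rank → E) (σ : Fin J.rank → ℝ) (i : Fin J.rank),
    J.IsJordanFrame c ∧ y = ∑ j, σ j • c j ∧ σ i = t

/-- `p` is a nearest point of the symmetric cone `K` to `v`. -/
def IsProj (J : EJA E) (v p : E) : Prop :=
  p ∈ J.K ∧ ∀ z ∈ J.K, ‖v - p‖ ≤ ‖v - z‖

/-- A (linear subspace that is a) subalgebra. -/
def IsSubalgebra (J : EJA E) (V : Submodule ℝ E) : Prop :=
  ∀ a ∈ V, ∀ b ∈ V, J.jmul a b ∈ V

/-- The algebra is simple: it is not the direct sum of two nonzero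
subalgebras. -/
def IsSimple (J : EJA E) : Prop :=
  ¬ ∃ V W : Submodule ℝ E, J.IsSubalgebra V ∧ J.IsSubalgebra W ∧
      V ≠ ⊥ ∧ W ≠ ⊥ ∧ V ⊓ W = ⊥ ∧ V ⊔ W = ⊤

/-- The tangent cone of the convex set `K` at `z`:
the closure of `⋃_{t>0} t (K - z)`. -/
def tangentCone (J : EJA E) (z : E) : Set E :=
  closure {d : E | ∃ t : ℝ, 0 < t ∧ ∃ k ∈ J.K, d = t • (k - z)}

/-- The lineality space `T_K(z) ∩ (-T_K(z))` of the tangent cone. -/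
def linTangent (J : EJA E) (z : E) : Set E :=
  {d : E | d ∈ J.tangentCone z ∧ -d ∈ J.tangentCone z}

/-- The Lagrangian of problem (P1):
`L(x, μ, λ) = f(x) - ⟪h(x), μ⟫ - ⟪g(x), λ⟫`. -/
def lagr {n m : ℕ} (f : EuclideanSpace ℝ (Fin n) → ℝ)
    (h : EuclideanSpace ℝ (Fin n) → EuclideanSpace ℝ (Fin m))
    (g : EuclideanSpace ℝ (Fin n) → E) (μ : EuclideanSpace ℝ (Fin m)) (lam : E)
    (x : EuclideanSpace ℝ (Fin n)) : ℝ :=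
  f x - ⟪h x, μ⟫ - ⟪g x, lam⟫

/-- The Lagrangian of the slack-variable problem (P2), as a function of the
pair `(x, y)`. -/
def lagrSlack (J : EJA E) {n m : ℕ} (f : EuclideanSpace ℝ (Fin n) → ℝ)
    (h : EuclideanSpace ℝ (Fin n) → EuclideanSpace ℝ (Fin m))
    (g : EuclideanSpace ℝ (Fin n) → E) (μ : EuclideanSpace ℝ (Fin m)) (lam : E)
    (p : EuclideanSpace ℝ (Fin n) × E) : ℝ :=
  f p.1 - ⟪h p.1, μ⟫ - ⟪g p.1 - J.jmul p.2 p.2, lam⟫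

/-- `(x, μ, lam)` is a KKT triple of problem (P1). -/
def KKTP1 (J : EJA E) {n m : ℕ} (f : EuclideanSpace ℝ (Fin n) → ℝ)
    (h : EuclideanSpace ℝ (Fin n) → EuclideanSpace ℝ (Fin m))
    (g : EuclideanSpace ℝ (Fin n) → E)
    (x : EuclideanSpace ℝ (Fin n)) (μ : EuclideanSpace ℝ (Fin m)) (lam : E) : Prop :=
  gradient f x - (fderiv ℝ h x).adjoint μ - (fderiv ℝ g x).adjoint lam = 0 ∧
    lam ∈ J.K ∧ g x ∈ J.K ∧ J.jmul lam (g x) = 0 ∧ h x = 0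

/-- `(x, y, μ, lam)` is a KKT quadruple of the slack-variable problem (P2). -/
def KKTP2 (J : EJA E) {n m : ℕ} (f : EuclideanSpace ℝ (Fin n) → ℝ)
    (h : EuclideanSpace ℝ (Fin n) → EuclideanSpace ℝ (Fin m))
    (g : EuclideanSpace ℝ (Fin n) → E)
    (x : EuclideanSpace ℝ (Fin n)) (y : E) (μ : EuclideanSpace ℝ (Fin m))
    (lam : E) : Prop :=
  gradient f x - (fderiv ℝ h x).adjoint μ - (fderiv ℝ g x).adjoint lam = 0 ∧
    J.jmul lam y = 0 ∧ g x = J.jmul y y ∧ h x = 0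

/-- The augmented Lagrangian of the slack-variable problem (P2). -/
def augSlack (J : EJA E) {n m : ℕ} (f : EuclideanSpace ℝ (Fin n) → ℝ)
    (h : EuclideanSpace ℝ (Fin n) → EuclideanSpace ℝ (Fin m))
    (g : EuclideanSpace ℝ (Fin n) → E) (ρ : ℝ) (μ : EuclideanSpace ℝ (Fin m))
    (lam : E) (x : EuclideanSpace ℝ (Fin n)) (y : E) : ℝ :=
  f x - ⟪h x, μ⟫ + ρ / 2 * ‖h x‖ ^ 2 - ⟪g x - J.jmul y y, lam⟫
    + ρ / 2 * ‖g x - J.jmul y y‖ ^ 2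

/-- The augmented Lagrangian of problem (P1), where `P` is the metric
projection onto the symmetric cone `K`. -/
def augSym (J : EJA E) {n m : ℕ} (f : EuclideanSpace ℝ (Fin n) → ℝ)
    (h : EuclideanSpace ℝ (Fin n) → EuclideanSpace ℝ (Fin m))
    (g : EuclideanSpace ℝ (Fin n) → E) (P : E → E) (ρ : ℝ)
    (μ : EuclideanSpace ℝ (Fin m)) (lam : E)
    (x : EuclideanSpace ℝ (Fin n)) : ℝ :=
  f x - ⟪h x, μ⟫ + ρ / 2 * ‖h x‖ ^ 2
    + 1 / (2 * ρ) * (-‖lam‖ ^ 2 + ‖P (lam - ρ • g x)‖ ^ 2)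

end EJA

namespace EJA

variable {E : Type*} [NormedAddCommGroup E] [InnerProductSpace ℝ E]
  [FiniteDimensional ℝ E]

/-- The Peirce polynomial identity `2 L³ - 3 L² + L = 0` for multiplication by an idempotent. -/
lemma peirce_identity (J : EJA E) {c : E} (hc : J.jmul c c = c) (w : E) :
    (2 : ℝ) • J.jmul c (J.jmul c (J.jmul c w)) =
      (3 : ℝ) • J.jmul c (J.jmul c w) - J.jmul c w := by
  have h₁ := J.jordan (c + w) c
  have h₂ := J.jordan (c - w) c
  have h₃ := J.jordan w c
  simp only [map_add, map_sub, LinearMap.add_apply, LinearMap.sub_apply, J.comm w c, hc] at h₁ h₂ h₃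
  simp only [J.comm (J.jmul c w) c] at h₁ h₂ h₃
  linear_combination (norm := skip) (1 / 2 : ℝ) • h₁ - (1 / 2 : ℝ) • h₂ - h₃
  simp only [J.comm (J.jmul w w) c]
  module

/-- Multiplication by an idempotent is positive semidefinite. -/
lemma inner_jmul_self_nonneg (J : EJA E) {c : E} (hc : J.jmul c c = c) (z : E) :
    0 ≤ ⟪c, J.jmul z z⟫ := by
  have hsymm (a b : E) : ⟪J.jmul c a, b⟫ = ⟪a, J.jmul c b⟫ := by
    rw [J.comm, J.assoc_inner]
  set u := J.jmul c z with hu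
  set w := J.jmul c u with hw
  have hP : (2 : ℝ) • J.jmul c w = (3 : ℝ) • w - u := J.peirce_identity hc z
  have h₁ : ⟪c, J.jmul z z⟫ = ⟪z, u⟫ := by
    rw [← J.assoc_inner, real_inner_comm]
  have h₂ : ⟪z, w⟫ = ⟪u, u⟫ := (hsymm z u).symm
  have h₃ : ⟪u, w⟫ = ⟪z, J.jmul c w⟫ := hsymm z w
  have h₄ : ⟪w, w⟫ = ⟪u, J.jmul c w⟫ := hsymm u w
  have h₅ := congrArg (fun v => ⟪z, v⟫) hP
  have h₆ := congrArg (fun v => ⟪u, v⟫) hP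
  simp only [inner_sub_right, real_inner_smul_right] at h₅ h₆
  have h₇ : 0 ≤ ⟪u, u⟫ := real_inner_self_nonneg
  have h₈ : 0 ≤ ⟪u - w, u - w⟫ := real_inner_self_nonneg
  rw [real_inner_sub_sub_self] at h₈
  linarith

/-- Products of elements that are diagonal in a common orthogonal system of idempotents. -/
lemma jmul_sum_smul (J : EJA E) {ι : Type*} [Fintype ι] {c : ι → E}
    (hc : ∀ i, J.jmul (c i) (c i) = c i) (ho : ∀ i j, i ≠ j → J.jmul (c i) (c j) = 0)
    (a b : ι → ℝ) :
    J.jmul (∑ i, a i • c i) (∑ i, b i • c i) = ∑ i, (a i * b i) • c i := by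
  simp only [map_sum, LinearMap.sum_apply, map_smul, LinearMap.smul_apply]
  refine Finset.sum_congr rfl fun i _ => ?_
  rw [Finset.sum_eq_single i]
  · rw [hc, smul_smul, mul_comm]
  · intro j _ hj
    simp [ho j i hj]
  · simp

/-- The symmetric cone is contained in its dual cone. -/
lemma inner_nonneg_of_mem_K (J : EJA E) {a b : E} (ha : a ∈ J.K) (hb : b ∈ J.K) :
    0 ≤ ⟪a, b⟫ := by
  obtain ⟨y, rfl⟩ := ha
  obtain ⟨z, rfl⟩ := hb
  obtain ⟨c, σ, hc, -, -, ho, -, rfl⟩ := J.spectral y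
  rw [J.jmul_sum_smul hc ho, sum_inner]
  refine Finset.sum_nonneg fun i _ => ?_
  rw [real_inner_smul_left]
  exact mul_nonneg (mul_self_nonneg _) (J.inner_jmul_self_nonneg (hc i) z)

lemma smul_mem_K (J : EJA E) {t : ℝ} (ht : 0 ≤ t) {a : E} (ha : a ∈ J.K) : t • a ∈ J.K := by
  obtain ⟨y, rfl⟩ := ha
  refine ⟨√t • y, ?_⟩
  simp only [map_smul, LinearMap.smul_apply, smul_smul, Real.mul_self_sqrt ht]

/-- Moreau decomposition along the symmetric cone. -/
lemma exists_sub_of_mem_K (J : EJA E) (v : E) :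
    ∃ p ∈ J.K, ∃ q ∈ J.K, ⟪p, q⟫ = 0 ∧ v = p - q := by
  obtain ⟨c, σ, hc, -, -, ho, -, rfl⟩ := J.spectral v
  have hmem (a : Fin J.rank → ℝ) (ha : ∀ i, 0 ≤ a i) : ∑ i, a i • c i ∈ J.K := by
    refine ⟨∑ i, √(a i) • c i, ?_⟩
    simp only [J.jmul_sum_smul hc ho, Real.mul_self_sqrt (ha _)]
  refine ⟨∑ i, (σ i)⁺ • c i, hmem _ fun i => posPart_nonneg _,
    ∑ i, (σ i)⁻ • c i, hmem _ fun i => negPart_nonneg _, ?_, ?_⟩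
  · have hzero (i : Fin J.rank) : (σ i)⁺ * (σ i)⁻ = 0 := by
      rcases le_total 0 (σ i) with h | h
      · rw [negPart_eq_zero.2 h, mul_zero]
      · rw [posPart_eq_zero.2 h, zero_mul]
    rw [← J.unit_jmul (∑ i, (σ i)⁺ • c i), J.assoc_inner, J.jmul_sum_smul hc ho]
    simp [hzero]
  · simp only [← Finset.sum_sub_distrib, ← sub_smul, posPart_sub_negPart]

/-- The nearest point of the symmetric cone is the positive part of a Moreau decomposition. -/
lemma IsProj.eq_of_sub {J : EJA E} {p q r : E} (hp : p ∈ J.K) (hq : q ∈ J.K)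
    (hpq : ⟪p, q⟫ = 0) (hr : J.IsProj (p - q) r) : r = p := by
  have h₁ := hr.2 p hp
  have h₂ := J.inner_nonneg_of_mem_K hr.1 hq
  have h₃ : ‖p - q - r‖ ^ 2 = ‖r - p‖ ^ 2 + 2 * ⟪r, q⟫ + ‖q‖ ^ 2 := by
    rw [show p - q - r = -((r - p) + q) by abel, norm_neg, norm_add_sq_real,
      inner_sub_left, hpq, sub_zero]
  rw [show p - q - p = -q by abel, norm_neg] at h₁
  have h₄ : ‖p - q - r‖ ^ 2 ≤ ‖q‖ ^ 2 := by gcongr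
  have h₅ : ‖r - p‖ ^ 2 = 0 := le_antisymm (by linarith) (sq_nonneg _)
  exact sub_eq_zero.1 (norm_eq_zero.1 (pow_eq_zero_iff two_ne_zero |>.1 h₅))

/-- Completing the square in the slack augmented Lagrangian. -/
lemma augSlack_eq (J : EJA E) {n m : ℕ} (f : EuclideanSpace ℝ (Fin n) → ℝ)
    (h : EuclideanSpace ℝ (Fin n) → EuclideanSpace ℝ (Fin m))
    (g : EuclideanSpace ℝ (Fin n) → E) {ρ : ℝ} (hρ : 0 < ρ) (μ : EuclideanSpace ℝ (Fin m))
    (lam : E) (x : EuclideanSpace ℝ (Fin n)) (y : E) :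
    J.augSlack f h g ρ μ lam x y =
      f x - ⟪h x, μ⟫ + ρ / 2 * ‖h x‖ ^ 2 - 1 / (2 * ρ) * ‖lam‖ ^ 2
        + ρ / 2 * ‖g x - ρ⁻¹ • lam - J.jmul y y‖ ^ 2 := by
  rw [augSlack, show g x - ρ⁻¹ • lam - J.jmul y y = g x - J.jmul y y - ρ⁻¹ • lam by abel,
    norm_sub_sq_real (g x - J.jmul y y), real_inner_smul_right, norm_smul, Real.norm_eq_abs,
    mul_pow, sq_abs]
  field_simp
  ring

end EJA

/-- partial minimization of the slack augmented Lagrangian over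
the slack variable `y`: the infimum is attained, equals the (P1) augmented
Lagrangian value, and any minimizer `y*` satisfies
`y*∘y* = P_K(g(x) - λ/ρ)`. -/
theorem stmt16 {E : Type*} [NormedAddCommGroup E] [InnerProductSpace ℝ E]
    [FiniteDimensional ℝ E] (J : EJA E) {n m : ℕ}
    (f : EuclideanSpace ℝ (Fin n) → ℝ)
    (h : EuclideanSpace ℝ (Fin n) → EuclideanSpace ℝ (Fin m))
    (g : EuclideanSpace ℝ (Fin n) → E)
    (P : E → E) (hP : ∀ v : E, J.IsProj v (P v))
    (ρ : ℝ) (hρ : 0 < ρ) (μ : EuclideanSpace ℝ (Fin m)) (lam : E)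
    (x : EuclideanSpace ℝ (Fin n)) :
    (∃ y0 : E,
      (∀ y : E, J.augSlack f h g ρ μ lam x y0 ≤ J.augSlack f h g ρ μ lam x y) ∧
      J.augSlack f h g ρ μ lam x y0 =
        f x - ⟪h x, μ⟫ + ρ / 2 * ‖h x‖ ^ 2
          + 1 / (2 * ρ) * (-‖lam‖ ^ 2 + ‖P (lam - ρ • g x)‖ ^ 2)) ∧
    ∀ y1 : E,
      (∀ y : E, J.augSlack f h g ρ μ lam x y1 ≤ J.augSlack f h g ρ μ lam x y) →
      J.jmul y1 y1 = P (g x - ρ⁻¹ • lam) := by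
  obtain ⟨p, hp, q, hq, hpq, hv⟩ := J.exists_sub_of_mem_K (g x - ρ⁻¹ • lam)
  have hPv : P (g x - ρ⁻¹ • lam) = p :=
    EJA.IsProj.eq_of_sub hp hq hpq (hv ▸ hP (g x - ρ⁻¹ • lam))
  have hneg : lam - ρ • g x = ρ • q - ρ • p := by
    rw [← smul_sub, ← neg_sub p q, ← hv, smul_neg, smul_sub, smul_inv_smul₀ hρ.ne', neg_sub]
  have hPneg : P (lam - ρ • g x) = ρ • q :=
    EJA.IsProj.eq_of_sub (J.smul_mem_K hρ.le hq) (J.smul_mem_K hρ.le hp)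
      (by rw [real_inner_smul_left, real_inner_smul_right, real_inner_comm, hpq]; simp)
      (hneg ▸ hP (lam - ρ • g x))
  have hle (y z : E) : J.augSlack f h g ρ μ lam x y ≤ J.augSlack f h g ρ μ lam x z ↔
      ‖g x - ρ⁻¹ • lam - J.jmul y y‖ ≤ ‖g x - ρ⁻¹ • lam - J.jmul z z‖ := by
    rw [J.augSlack_eq f h g hρ, J.augSlack_eq f h g hρ, add_le_add_iff_left,
      mul_le_mul_iff_right₀ (half_pos hρ), sq_le_sq₀ (norm_nonneg _) (norm_nonneg _)]
  constructor
  · obtain ⟨y0, hy0⟩ := hp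
    refine ⟨y0, fun y => ?_, ?_⟩
    · rw [hle, ← hy0, ← hPv]
      exact (hP _).2 _ ⟨y, rfl⟩
    · rw [J.augSlack_eq f h g hρ, hPneg, ← hy0, hv, sub_sub_cancel_left, norm_neg, norm_smul,
        Real.norm_eq_abs, mul_pow, sq_abs]
      field_simp
      ring
  · intro y1 hy1
    rw [hPv]
    refine EJA.IsProj.eq_of_sub hp hq hpq ⟨⟨y1, rfl⟩, ?_⟩
    rintro _ ⟨z, rfl⟩
    rw [← hv, ← hle]
    exact hy1 z
end
end

section
/- Let (E, ∘, ⟨·,·⟩) be a Euclidean Jordan algebra, let c ∈ E be an idempotent and let w ∈ V(c, 1/2) = {z ∈ E : c∘z = z/2}. Then there exist w₀ ∈ V(c, 0) and w₁ ∈ V(c, 1) such that w∘w = w₀∘w₀ + w₁∘w₁ and ‖w₀∘w₀‖ = ‖w₁∘w₁‖. -/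
open scoped RealInnerProductSpace

noncomputable section

namespace EJA

variable {E : Type*} [NormedAddCommGroup E] [InnerProductSpace ℝ E]
  [FiniteDimensional ℝ E]

/-- The Jordan identity, linearized once in the repeated variable. -/
theorem jordan_linearized (J : EJA E) (x y z : E) :
    J.jmul x (J.jmul (J.jmul y y) z) + (2 : ℝ) • J.jmul y (J.jmul (J.jmul x y) z) =
      J.jmul (J.jmul y y) (J.jmul x z) + (2 : ℝ) • J.jmul (J.jmul x y) (J.jmul y z) := by
  have hadd := J.jordan (y + x) z
  have hsub := J.jordan (y - x) z
  have hx := J.jordan x z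
  simp only [map_add, map_sub, LinearMap.add_apply, LinearMap.sub_apply, J.comm y x]
    at hadd hsub
  linear_combination (norm := module) (1 / 2 : ℝ) • hadd - (1 / 2 : ℝ) • hsub - hx

theorem IsIdempotent.jmul_cubic {J : EJA E} {p : E} (hp : J.IsIdempotent p) (x : E) :
    J.jmul p (J.jmul p (J.jmul p x)) =
      (3 / 2 : ℝ) • J.jmul p (J.jmul p x) - (1 / 2 : ℝ) • J.jmul p x := by
  have h := J.jordan_linearized x p p
  simp only [show J.jmul p p = p from hp, J.comm x p, J.comm (J.jmul p x) p] at h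
  linear_combination (norm := module) (1 / 2 : ℝ) • h

theorem inner_jmul_left (J : EJA E) (p x y : E) : ⟪J.jmul p x, y⟫ = ⟪x, J.jmul p y⟫ := by
  rw [J.comm, J.assoc_inner]

/-- Sum-of-squares form of `⟪p∘x, x⟫`: the Peirce components of `x` for the eigenvalues
`1` and `1/2` are `2 p∘(p∘x) - p∘x` and `4 (p∘x - p∘(p∘x))`. -/
theorem IsIdempotent.inner_jmul_self_eq {J : EJA E} {p : E} (hp : J.IsIdempotent p) (x : E) :
    ⟪J.jmul p x, x⟫ = ‖(2 : ℝ) • J.jmul p (J.jmul p x) - J.jmul p x‖ ^ 2 +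
      8 * ‖J.jmul p x - J.jmul p (J.jmul p x)‖ ^ 2 := by
  have huu : ⟪J.jmul p x, J.jmul p x⟫ = ⟪J.jmul p (J.jmul p x), x⟫ :=
    (J.inner_jmul_left p _ _).symm
  have hvu : ⟪J.jmul p (J.jmul p x), J.jmul p x⟫ =
      ⟪J.jmul p (J.jmul p (J.jmul p x)), x⟫ := (J.inner_jmul_left p _ _).symm
  have hvv : ⟪J.jmul p (J.jmul p x), J.jmul p (J.jmul p x)⟫ =
      ⟪J.jmul p (J.jmul p (J.jmul p x)), J.jmul p x⟫ := (J.inner_jmul_left p _ _).symm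
  rw [hp.jmul_cubic, inner_sub_left, real_inner_smul_left, real_inner_smul_left] at hvu hvv
  rw [← real_inner_self_eq_norm_sq, ← real_inner_self_eq_norm_sq]
  simp only [inner_sub_left, inner_sub_right, real_inner_smul_left, real_inner_smul_right,
    real_inner_comm (J.jmul p (J.jmul p x)) (J.jmul p x)]
  linarith

theorem IsIdempotent.inner_jmul_self_nonneg {J : EJA E} {p : E} (hp : J.IsIdempotent p)
    (x : E) : 0 ≤ ⟪J.jmul p x, x⟫ := by
  rw [hp.inner_jmul_self_eq]
  positivity

theorem IsIdempotent.jmul_eq_zero_of_inner_eq_zero {J : EJA E} {p : E}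
    (hp : J.IsIdempotent p) {x : E} (h : ⟪J.jmul p x, x⟫ = 0) : J.jmul p x = 0 := by
  rw [hp.inner_jmul_self_eq] at h
  have h₁ : (2 : ℝ) • J.jmul p (J.jmul p x) - J.jmul p x = 0 := by
    rw [← norm_eq_zero, ← sq_eq_zero_iff]
    nlinarith [sq_nonneg ‖(2 : ℝ) • J.jmul p (J.jmul p x) - J.jmul p x‖,
      sq_nonneg ‖J.jmul p x - J.jmul p (J.jmul p x)‖]
  have h₂ : J.jmul p x - J.jmul p (J.jmul p x) = 0 := by
    rw [← norm_eq_zero, ← sq_eq_zero_iff]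
    nlinarith [sq_nonneg ‖(2 : ℝ) • J.jmul p (J.jmul p x) - J.jmul p x‖,
      sq_nonneg ‖J.jmul p x - J.jmul p (J.jmul p x)‖]
  linear_combination (norm := module) h₁ + (2 : ℝ) • h₂

theorem jmul_unit (J : EJA E) (y : E) : J.jmul y J.unit = y := by
  rw [J.comm, J.unit_jmul]

theorem IsIdempotent.unit_sub {J : EJA E} {c : E} (hc : J.IsIdempotent c) :
    J.IsIdempotent (J.unit - c) := by
  have hc' : J.jmul c c = c := hc
  simp only [IsIdempotent, map_sub, LinearMap.sub_apply, J.unit_jmul, J.jmul_unit, hc']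
  abel

theorem sum_smul_jmul_sum_smul (J : EJA E) {ι : Type*} [Fintype ι] {f : ι → E}
    (hf : ∀ i, J.IsIdempotent (f i)) (hort : ∀ i j, i ≠ j → J.jmul (f i) (f j) = 0)
    (σ τ : ι → ℝ) :
    J.jmul (∑ i, σ i • f i) (∑ i, τ i • f i) = ∑ i, (σ i * τ i) • f i := by
  simp only [map_sum, LinearMap.sum_apply, map_smul, LinearMap.smul_apply]
  refine Finset.sum_congr rfl fun i _ => ?_
  rw [Finset.sum_eq_single i]
  · rw [show J.jmul (f i) (f i) = f i from hf i, smul_smul, mul_comm]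
  · intro j _ hj
    rw [hort j i hj, smul_zero]
  · simp

/-- If the product of an idempotent `c` with a square `w∘w` lies in `V(c, 1)`, then it is the
square of an element of `V(c, 1)`. -/
theorem IsIdempotent.exists_sq_eq_jmul_sq {J : EJA E} {c : E} (hc : J.IsIdempotent c) {w : E}
    (hw : J.jmul c (J.jmul c (J.jmul w w)) = J.jmul c (J.jmul w w)) :
    ∃ s, J.jmul c s = s ∧ J.jmul s s = J.jmul c (J.jmul w w) := by
  obtain ⟨f, σ, hf, hf0, -, hort, -, hσ⟩ := J.spectral (J.jmul c (J.jmul w w))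
  set a := J.jmul c (J.jmul w w)
  set d := J.unit - c with hd
  have hdd : J.IsIdempotent d := hc.unit_sub
  have hda : J.jmul d a = 0 := by
    rw [hd, map_sub, LinearMap.sub_apply, J.unit_jmul, hw, sub_self]
  have hdf : ∀ i, ⟪d, f i⟫ = ⟪J.jmul (f i) d, d⟫ := fun i => by
    rw [J.assoc_inner, show J.jmul d d = d from hdd, real_inner_comm]
  have hsum : ∑ i, (σ i * σ i) * ⟪d, f i⟫ = 0 := by
    have h : ⟪d, J.jmul a a⟫ = 0 := by rw [← J.assoc_inner, hda, inner_zero_left]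
    rw [hσ, J.sum_smul_jmul_sum_smul hf hort, inner_sum] at h
    simpa only [real_inner_smul_right] using h
  have hfc : ∀ i, σ i ≠ 0 → J.jmul c (f i) = f i := fun i hi => by
    have h := (Finset.sum_eq_zero_iff_of_nonneg fun j _ => mul_nonneg (mul_self_nonneg (σ j))
      (by rw [hdf]; exact IsIdempotent.inner_jmul_self_nonneg (hf j) d)).1 hsum i
      (Finset.mem_univ i)
    have h0 := IsIdempotent.jmul_eq_zero_of_inner_eq_zero (hf i)
      ((hdf i).symm.trans ((mul_eq_zero.1 h).resolve_left (mul_self_ne_zero.2 hi)))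
    rw [J.comm, hd, map_sub, LinearMap.sub_apply, J.unit_jmul, sub_eq_zero] at h0
    exact h0.symm
  have hσ0 : ∀ i, 0 ≤ σ i := fun i => by
    by_cases hi : σ i = 0
    · exact hi.ge
    have h₁ : ⟪a, f i⟫ = σ i * ⟪f i, f i⟫ := by
      rw [hσ, sum_inner, Finset.sum_eq_single i]
      · rw [real_inner_smul_left]
      · intro j _ hj
        rw [real_inner_smul_left, ← hf j, J.assoc_inner, hort j i hj, inner_zero_right, mul_zero]
      · simp
    have h₂ : 0 ≤ ⟪a, f i⟫ := by
      rw [J.inner_jmul_left, hfc i hi, J.assoc_inner, J.comm w, real_inner_comm]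
      exact IsIdempotent.inner_jmul_self_nonneg (hf i) w
    rw [h₁] at h₂
    exact nonneg_of_mul_nonneg_left h₂ (real_inner_self_pos.2 (hf0 i))
  refine ⟨∑ i, √(σ i) • f i, ?_, ?_⟩
  · rw [map_sum]
    refine Finset.sum_congr rfl fun i _ => ?_
    by_cases hi : σ i = 0
    · simp [hi]
    · rw [map_smul, hfc i hi]
  · rw [J.sum_smul_jmul_sum_smul hf hort, hσ]
    exact Finset.sum_congr rfl fun i _ => by rw [Real.mul_self_sqrt (hσ0 i)]

/-- The square of an element of `V(c, 1/2)` has no component in `V(c, 1/2)`. -/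
theorem IsIdempotent.jmul_jmul_sq_of_half {J : EJA E} {c w : E} (hc : J.IsIdempotent c)
    (hw : J.jmul c w = (1 / 2 : ℝ) • w) :
    J.jmul c (J.jmul c (J.jmul w w)) = J.jmul c (J.jmul w w) := by
  have h := J.jordan_linearized c w c
  rw [show J.jmul c c = c from hc, hw, J.comm w c, hw, J.comm _ c] at h
  simp only [map_smul, LinearMap.smul_apply, J.comm w c, hw] at h
  linear_combination (norm := module) h

/-- The components of `w∘w` in `V(c, 1)` and `V(c, 0)` have equal norm if `w ∈ V(c, 1/2)`. -/
theorem norm_jmul_sq_of_half (J : EJA E) {c w : E}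
    (hw : J.jmul c w = (1 / 2 : ℝ) • w) :
    ‖J.jmul (J.unit - c) (J.jmul w w)‖ = ‖J.jmul c (J.jmul w w)‖ := by
  have hinner : ⟪J.jmul c (J.jmul w w), J.jmul w w⟫ = 1 / 2 * ⟪J.jmul w w, J.jmul w w⟫ := by
    have h := J.jordan w c
    rw [J.comm w c, hw, J.comm _ c, map_smul] at h
    rw [← J.inner_jmul_left, h, real_inner_smul_left, J.comm (J.jmul w w) w, J.inner_jmul_left]
  rw [map_sub, LinearMap.sub_apply, J.unit_jmul,
    ← sq_eq_sq₀ (norm_nonneg _) (norm_nonneg _), norm_sub_sq_real, real_inner_comm,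
    hinner, real_inner_self_eq_norm_sq]
  ring

end EJA

/-- for `w` in the Peirce eigenspace `V(c, 1/2)` of an
idempotent `c`, `w∘w = w₀∘w₀ + w₁∘w₁` with `w₀ ∈ V(c,0)`, `w₁ ∈ V(c,1)` and
`‖w₀∘w₀‖ = ‖w₁∘w₁‖`. -/
theorem stmt18 {E : Type*} [NormedAddCommGroup E] [InnerProductSpace ℝ E]
    [FiniteDimensional ℝ E] (J : EJA E) (c w : E)
    (hc : J.IsIdempotent c) (hw : J.jmul c w = (1 / 2 : ℝ) • w) :
    ∃ w0 w1 : E, J.jmul c w0 = 0 ∧ J.jmul c w1 = w1 ∧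
      J.jmul w w = J.jmul w0 w0 + J.jmul w1 w1 ∧
      ‖J.jmul w0 w0‖ = ‖J.jmul w1 w1‖ := by
  have hc' := hc.unit_sub
  have hw₁ := hc.jmul_jmul_sq_of_half hw
  have hw₀ : J.jmul (J.unit - c) w = (1 / 2 : ℝ) • w := by
    rw [map_sub, LinearMap.sub_apply, J.unit_jmul, hw]
    module
  obtain ⟨w1, h1, hs1⟩ := hc.exists_sq_eq_jmul_sq hw₁
  obtain ⟨w0, h0, hs0⟩ := hc'.exists_sq_eq_jmul_sq (hc'.jmul_jmul_sq_of_half hw₀)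
  refine ⟨w0, w1, ?_, h1, ?_, ?_⟩
  · rwa [map_sub, LinearMap.sub_apply, J.unit_jmul, sub_eq_self] at h0
  · rw [hs0, hs1, map_sub, LinearMap.sub_apply, J.unit_jmul, sub_add_cancel]
  · rw [hs0, hs1, J.norm_jmul_sq_of_half hw]
end
end
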